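/- arXiv:1607.03279 — 2 statements merged into one kernel-verified Lean document; each statement's English description precedes it below -/
import Mathlib

section
/- Suppose 0 ≤ α < 1. There exists a dense G_δ set G in the space C₁^α[0,1] = {f : [0,1] → ℝ : |f(x) − f(y)| ≤ |x−y|^α} with the sup metric (in C[0,1] when α = 0) such that for every f ∈ G and every A ⊆ [0,1] on which f is monotone, the lower Minkowski dimension of A is at most α (and hence dim_H A ≤ α). -/
open Set MeasureTheory

/-- The space `C₁^α[0,1]` of functions on `[0,1]` with `|f x - f y| ≤ |x-y|^α`
(all of `C[0,1]` when `α = 0`), with the sup metric. -/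
def HolderSet (α : ℝ) : Set C(Icc (0:ℝ) 1, ℝ) :=
  {f | α = 0 ∨ ∀ x y : Icc (0:ℝ) 1, |f x - f y| ≤ |(x : ℝ) - (y : ℝ)| ^ α}

/-- Number of dyadic grid intervals `[(j-1)/2^ℓ, j/2^ℓ]` meeting `A`. -/
noncomputable def gridCount (ℓ : ℕ) (A : Set ℝ) : ℕ :=
  Set.ncard {j : ℤ | (A ∩ Icc (((j : ℝ) - 1) / 2 ^ ℓ) ((j : ℝ) / 2 ^ ℓ)).Nonempty}

/-- Lower Minkowski (box) dimension via dyadic grid counts. -/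
noncomputable def lowerMinkowskiDim (A : Set ℝ) : ℝ :=
  Filter.liminf (fun ℓ : ℕ => Real.log (gridCount ℓ A) / (ℓ * Real.log 2)) Filter.atTop

/-- A bounded uniformly continuous function is uniformly approximated by its infimal convolutions
with `L * |·|`, which are Lipschitz and inherit translation-invariant bounds on increments. -/
lemma exists_lipschitz_approx (g : ℝ → ℝ) (B : ℝ) (hB : ∀ x, |g x| ≤ B)
    (hg : UniformContinuous g) (ε : ℝ) (hε : 0 < ε) :
    ∃ L > 0, ∃ u : ℝ → ℝ, (∀ x y, |u x - u y| ≤ L * |x - y|) ∧ (∀ x, |u x - g x| ≤ ε) ∧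
      ∀ x y c, (∀ t, |g (x + t) - g (y + t)| ≤ c) → |u x - u y| ≤ c := by
  obtain ⟨δ, hδ, hgδ⟩ := Metric.uniformContinuous_iff.1 hg ε hε
  have hB0 : 0 ≤ B := (abs_nonneg _).trans (hB 0)
  set L : ℝ := (2 * B + 1) / δ with hL
  have hL0 : 0 < L := by positivity
  have hbdd : ∀ x, BddBelow (range fun t => g (x + t) + L * |t|) := by
    intro x
    refine ⟨-B, ?_⟩
    rintro _ ⟨t, rfl⟩
    have h1 := (abs_le.1 (hB (x + t))).1
    have h2 : 0 ≤ L * |t| := by positivity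
    simp only
    linarith
  have hlip : ∀ x y, (⨅ t, (g (x + t) + L * |t|)) ≤ (⨅ t, (g (y + t) + L * |t|)) + L * |x - y| := by
    intro x y
    rw [← sub_le_iff_le_add]
    refine le_ciInf fun t => ?_
    have h1 := ciInf_le (hbdd x) (y - x + t)
    have h2 : x + (y - x + t) = y + t := by ring
    simp only [h2] at h1
    have h3 : |y - x + t| ≤ |x - y| + |t| := by
      rw [abs_sub_comm x y]
      exact abs_add_le _ _
    nlinarith [mul_le_mul_of_nonneg_left h3 hL0.le]
  have hinc : ∀ x y c, (∀ t, |g (x + t) - g (y + t)| ≤ c) →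
      (⨅ t, (g (x + t) + L * |t|)) ≤ (⨅ t, (g (y + t) + L * |t|)) + c := by
    intro x y c h
    rw [← sub_le_iff_le_add]
    refine le_ciInf fun t => ?_
    have h1 := ciInf_le (hbdd x) t
    have h2 := (abs_le.1 (h t)).2
    linarith
  refine ⟨L, hL0, fun x => ⨅ t, (g (x + t) + L * |t|), fun x y => ?_, fun x => ?_,
    fun x y c h => ?_⟩
  · have h1 := hlip x y
    have h2 := hlip y x
    rw [abs_sub_comm y x] at h2
    exact abs_le.2 ⟨by linarith, by linarith⟩
  · have h1 : (⨅ t, (g (x + t) + L * |t|)) ≤ g x := by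
      simpa using ciInf_le (hbdd x) 0
    have h2 : g x - ε ≤ ⨅ t, (g (x + t) + L * |t|) := by
      refine le_ciInf fun t => ?_
      by_cases ht : |t| < δ
      · have h3 := hgδ (show dist (x + t) x < δ by simpa [Real.dist_eq] using ht)
        have h4 := (abs_lt.1 (Real.dist_eq _ _ ▸ h3)).1
        have h5 : 0 ≤ L * |t| := by positivity
        linarith
      · have h3 : L * δ ≤ L * |t| := mul_le_mul_of_nonneg_left (not_lt.1 ht) hL0.le
        have h4 : L * δ = 2 * B + 1 := by rw [hL]; field_simp
        have h5 := (abs_le.1 (hB (x + t))).1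
        have h6 := (abs_le.1 (hB x)).2
        linarith
    exact abs_le.2 ⟨by linarith, by linarith⟩
  · have h1 := hinc x y c h
    have h2 := hinc y x c fun t => by rw [abs_sub_comm]; exact h t
    exact abs_le.2 ⟨by linarith, by linarith⟩

/-- A periodic profile on `ℝ` with period `1`, which decreases with slope `-1` on most of the period
when `θ` is small, and climbs back with slope `1 / θ` on an interval of length at most `θ`. -/
noncomputable def sawtooth (θ t : ℝ) : ℝ :=
  max (1 - Int.fract t) (1 - (1 - Int.fract t) / θ)

lemma sawtooth_nonneg (θ t : ℝ) : 0 ≤ sawtooth θ t :=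
  le_max_of_le_left (by linarith [Int.fract_lt_one t])

lemma sawtooth_le_one {θ : ℝ} (hθ : 0 < θ) (t : ℝ) : sawtooth θ t ≤ 1 := by
  have h1 := Int.fract_nonneg t
  have h2 : 0 ≤ (1 - Int.fract t) / θ := div_nonneg (by linarith [Int.fract_lt_one t]) hθ.le
  exact max_le (by linarith) (by linarith)

lemma abs_sawtooth_sub_le {θ : ℝ} (hθ : 0 < θ) (hθ1 : θ ≤ 1) (x y : ℝ) :
    |sawtooth θ x - sawtooth θ y| ≤ |x - y| / θ := by
  wlog hxy : x ≤ y generalizing x y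
  · rw [abs_sub_comm, abs_sub_comm x y]
    exact this y x (le_of_not_ge hxy)
  have hle : ∀ a : ℝ, 0 ≤ a → a ≤ a / θ := fun a ha => le_div_self ha hθ hθ1
  rw [abs_sub_comm x y, abs_of_nonneg (sub_nonneg.2 hxy)]
  rcases (Int.floor_mono hxy).eq_or_lt with h | h
  · have hfr : Int.fract y - Int.fract x = y - x := by
      simp only [Int.fract, h]
      ring
    refine (abs_max_sub_max_le_max _ _ _ _).trans (max_le ?_ ?_)
    · rw [show 1 - Int.fract x - (1 - Int.fract y) = y - x by linarith,
        abs_of_nonneg (sub_nonneg.2 hxy)]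
      exact hle _ (sub_nonneg.2 hxy)
    · rw [show 1 - (1 - Int.fract x) / θ - (1 - (1 - Int.fract y) / θ) = -((y - x) / θ) by
        rw [← hfr]; ring, abs_neg, abs_of_nonneg (div_nonneg (sub_nonneg.2 hxy) hθ.le)]
  · have hxl : 1 - (1 - Int.fract x) / θ ≤ sawtooth θ x := le_max_right _ _
    have hyl : 1 - Int.fract y ≤ sawtooth θ y := le_max_left _ _
    have hy := hle _ (Int.fract_nonneg y)
    have hx0 : 0 ≤ (1 - Int.fract x) / θ :=
      div_nonneg (by linarith [Int.fract_lt_one x]) hθ.le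
    have hsum : (1 - Int.fract x) / θ + Int.fract y / θ ≤ (y - x) / θ := by
      rw [← add_div]
      refine div_le_div_of_nonneg_right ?_ hθ.le
      have h' : (⌊x⌋ : ℝ) + 1 ≤ ⌊y⌋ := by exact_mod_cast h
      simp only [Int.fract]
      linarith
    have hx1 := sawtooth_le_one hθ x
    have hy1 := sawtooth_le_one hθ y
    have hy0 := Int.fract_nonneg y
    exact abs_le.2 ⟨by linarith, by linarith⟩

lemma sawtooth_of_fract_le {θ t : ℝ} (hθ : 0 < θ) (ht : Int.fract t ≤ 1 / (1 + θ)) :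
    sawtooth θ t = 1 - Int.fract t := by
  refine max_eq_left ?_
  rw [le_div_iff₀ (by linarith)] at ht
  have : Int.fract t ≤ (1 - Int.fract t) / θ := by
    rw [le_div_iff₀ hθ]
    linarith
  linarith

/-- An oscillation of period `p` and amplitude `M * p` that decreases with slope `-M` except on
intervals of length `τ`, one per period. -/
lemma exists_oscillation {M p τ : ℝ} (hM : 0 < M) (hp : 0 < p) (hτ : 0 < τ) (hτp : τ ≤ p) :
    ∃ φ : ℝ → ℝ, (∀ x, 0 ≤ φ x ∧ φ x ≤ M * p) ∧
      (∀ x y, |φ x - φ y| ≤ M * p * (|x - y| / τ)) ∧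
      ∀ k : ℤ, ∃ c, (k + 1) * p - τ ≤ c ∧
        ∀ x ∈ Icc (k * p) c, ∀ y ∈ Icc (k * p) c, φ y - φ x = -(M * (y - x)) := by
  have hθ : 0 < τ / p := div_pos hτ hp
  have hθ1 : τ / p ≤ 1 := (div_le_one hp).2 hτp
  refine ⟨fun x => M * p * sawtooth (τ / p) (x / p), fun x => ⟨?_, ?_⟩, fun x y => ?_, fun k => ?_⟩
  · exact mul_nonneg (by positivity) (sawtooth_nonneg _ _)
  · exact mul_le_of_le_one_right (by positivity) (sawtooth_le_one hθ _)
  · simp only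
    rw [← mul_sub, abs_mul, abs_of_pos (mul_pos hM hp)]
    refine mul_le_mul_of_nonneg_left ?_ (by positivity)
    refine (abs_sawtooth_sub_le hθ hθ1 _ _).trans_eq ?_
    rw [← sub_div, abs_div, abs_of_pos hp]
    field_simp
  · have hc1 : 1 / (1 + τ / p) < 1 := by
      rw [div_lt_one (by positivity)]
      linarith
    have key : ∀ x ∈ Icc (k * p) (k * p + p * (1 / (1 + τ / p))),
        M * p * sawtooth (τ / p) (x / p) = M * p * (1 - (x / p - k)) := by
      rintro x ⟨hx1, hx2⟩
      have h1 : (k : ℝ) ≤ x / p := (le_div_iff₀ hp).2 hx1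
      have h2 : x / p ≤ k + 1 / (1 + τ / p) := by
        rw [div_le_iff₀ hp]
        linarith
      have hfl : ⌊x / p⌋ = k := Int.floor_eq_iff.2 ⟨h1, by linarith⟩
      have hfr : Int.fract (x / p) = x / p - k := by rw [Int.fract, hfl]
      rw [sawtooth_of_fract_le hθ (by rw [hfr]; linarith), hfr]
    refine ⟨k * p + p * (1 / (1 + τ / p)), ?_, fun x hx y hy => ?_⟩
    · have h1 : p - p * (1 / (1 + τ / p)) = τ / (1 + τ / p) := by
        field_simp
        ring
      have h2 : τ / (1 + τ / p) ≤ τ := div_le_self hτ.le (by linarith)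
      linarith
    · simp only
      rw [key x hx, key y hy]
      field_simp
      ring

lemma finite_gridIndices {A : Set ℝ} (hA : A ⊆ Icc 0 1) (ℓ : ℕ) :
    {j : ℤ | (A ∩ Icc (((j : ℝ) - 1) / 2 ^ ℓ) ((j : ℝ) / 2 ^ ℓ)).Nonempty}.Finite := by
  refine (Set.finite_Icc (0 : ℤ) (2 ^ ℓ + 1)).subset ?_
  rintro j ⟨x, hxA, hx1, hx2⟩
  obtain ⟨h0, h1⟩ := hA hxA
  have h2 : (0 : ℝ) < 2 ^ ℓ := by positivity
  rw [div_le_iff₀ h2] at hx1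
  rw [le_div_iff₀ h2] at hx2
  constructor
  · have : (0 : ℝ) ≤ j := (mul_nonneg h0 h2.le).trans hx2
    exact_mod_cast this
  · have : (j : ℝ) ≤ 2 ^ ℓ + 1 := by nlinarith
    exact_mod_cast this

/-- If `A` is covered by finitely many sets, each of which meets `A` in diameter at most `2 ^ (-ℓ)`,
then the grid count is at most five times the number of these sets. -/
lemma gridCount_le_of_cover {ι : Type*} {A : Set ℝ} (ℓ : ℕ) (s : Finset ι)
    (S : ι → Set ℝ) (hcov : ∀ x ∈ A, ∃ i ∈ s, x ∈ S i)
    (hS : ∀ i, ∀ x ∈ A ∩ S i, ∀ y ∈ A ∩ S i, x < y → y - x ≤ (2 ^ ℓ)⁻¹) :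
    gridCount ℓ A ≤ s.card * 5 := by
  have h2 : (0 : ℝ) < 2 ^ ℓ := by positivity
  set J : ι → Set ℤ := fun i =>
    {j : ℤ | (A ∩ S i ∩ Icc (((j : ℝ) - 1) / 2 ^ ℓ) ((j : ℝ) / 2 ^ ℓ)).Nonempty} with hJ
  have hJ2 : ∀ i, ∀ j ∈ J i, ∀ j' ∈ J i, j ≤ j' + 2 := by
    rintro i j ⟨x, hx, hx1, hx2⟩ j' ⟨y, hy, hy1, hy2⟩
    rw [div_le_iff₀ h2] at hx1 hy1
    rw [le_div_iff₀ h2] at hx2 hy2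
    have hxy : (x - y) * 2 ^ ℓ ≤ 1 := by
      rcases lt_or_ge y x with h | h
      · have := mul_le_mul_of_nonneg_right (hS i y hy x hx h) h2.le
        rwa [inv_mul_cancel₀ h2.ne'] at this
      · nlinarith
    have : (j : ℝ) ≤ j' + 2 := by linarith
    exact_mod_cast this
  have hJcard : ∀ i, (J i).Finite ∧ (J i).ncard ≤ 5 := by
    intro i
    rcases (J i).eq_empty_or_nonempty with h | ⟨j₀, hj₀⟩
    · simp [h]
    · have hsub : J i ⊆ ↑(Finset.Icc (j₀ - 2) (j₀ + 2)) := by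
        intro j hj
        have h3 := hJ2 i j hj j₀ hj₀
        have h4 := hJ2 i j₀ hj₀ j hj
        simp only [Finset.coe_Icc, mem_Icc]
        omega
      refine ⟨(Finset.finite_toSet _).subset hsub, ?_⟩
      refine (Set.ncard_le_ncard hsub (Finset.finite_toSet _)).trans ?_
      rw [Set.ncard_coe_finset, Int.card_Icc]
      omega
  have hsub : {j : ℤ | (A ∩ Icc (((j : ℝ) - 1) / 2 ^ ℓ) ((j : ℝ) / 2 ^ ℓ)).Nonempty} ⊆
      ⋃ i ∈ s, J i := by
    rintro j ⟨x, hxA, hx⟩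
    obtain ⟨i, hi, hxi⟩ := hcov x hxA
    exact mem_biUnion hi ⟨x, ⟨hxA, hxi⟩, hx⟩
  calc gridCount ℓ A ≤ (⋃ i ∈ s, J i).ncard :=
        Set.ncard_le_ncard hsub (s.finite_toSet.biUnion fun i _ => (hJcard i).1)
    _ ≤ ∑ i ∈ s, (J i).ncard := Finset.set_ncard_biUnion_le _ _
    _ ≤ s.card * 5 := Finset.sum_le_card_nsmul _ _ _ fun i _ => (hJcard i).2

lemma isClosed_holderSet (α : ℝ) : IsClosed (HolderSet α) := by
  have : HolderSet α = {_f | α = 0} ∪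
      ⋂ x : Icc (0 : ℝ) 1, ⋂ y : Icc (0 : ℝ) 1, {f | |f x - f y| ≤ |(x : ℝ) - (y : ℝ)| ^ α} := by
    ext f
    simp only [HolderSet, mem_union, mem_iInter, mem_ofPred_eq]
  rw [this]
  refine isClosed_const.union (isClosed_iInter fun x => isClosed_iInter fun y => ?_)
  exact isClosed_le (by fun_prop) continuous_const

lemma neg_mem_holderSet {α : ℝ} {f : C(Icc (0 : ℝ) 1, ℝ)} (hf : f ∈ HolderSet α) :
    -f ∈ HolderSet α := by
  refine hf.imp id fun h x y => ?_
  have := h y x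
  rw [abs_sub_comm (y : ℝ)] at this
  simpa [neg_add_eq_sub] using this

lemma min_one_le_rpow {α t : ℝ} (hα0 : 0 ≤ α) (hα1 : α ≤ 1) (ht : 0 ≤ t) : min 1 t ≤ t ^ α := by
  rcases le_total t 1 with h | h
  · refine (min_le_right _ _).trans ?_
    simpa using Real.rpow_le_rpow_of_exponent_ge' ht h hα0 hα1
  · exact (min_le_left _ _).trans (Real.one_le_rpow h hα0)

/-- A monotone set of a function uniformly close to `u + φ` is met by few dyadic intervals, when `φ`
oscillates as in `exists_oscillation` and `u` is Lipschitz with a smaller constant. -/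
lemma gridCount_le_of_monotoneOn {L p : ℝ} (hp : 0 < p) (hp1 : p ≤ 1) (ℓ : ℕ)
    {u φ h : ℝ → ℝ} (hu : ∀ x y, |u x - u y| ≤ L * |x - y|)
    (hφ : ∀ k : ℤ, ∃ c, (k + 1) * p - ((2 : ℝ) ^ ℓ)⁻¹ ≤ c ∧
        ∀ x ∈ Icc (k * p) c, ∀ y ∈ Icc (k * p) c, φ y - φ x = -((L + 1) * (y - x)))
    {A : Set ℝ} (hA : A ⊆ Icc 0 1) (hh : ∀ x ∈ A, |h x - (u x + φ x)| ≤ ((2 : ℝ) ^ ℓ)⁻¹ / 2)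
    (hmono : MonotoneOn h A) : (gridCount ℓ A : ℝ) ≤ 20 * p⁻¹ := by
  choose c hc hcφ using hφ
  have hcover := gridCount_le_of_cover (A := A) ℓ
    (Finset.Icc (0 : ℤ) ⌊p⁻¹⌋ ×ˢ (Finset.univ : Finset Bool))
    (fun i => if i.2 then Icc (i.1 * p) (c i.1) else Icc (c i.1) ((i.1 + 1) * p)) ?_ ?_
  · rw [Finset.card_product, Finset.card_univ, Fintype.card_bool, Int.card_Icc] at hcover
    have hfl0 : 0 ≤ ⌊p⁻¹⌋ := Int.floor_nonneg.2 (by positivity)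
    have h1 : (((⌊p⁻¹⌋ + 1 - 0).toNat : ℤ) : ℝ) = ⌊p⁻¹⌋ + 1 := by
      rw [Int.toNat_of_nonneg (by omega)]
      push_cast
      ring
    rw [Int.cast_natCast] at h1
    have h2 : (gridCount ℓ A : ℝ) ≤ (((⌊p⁻¹⌋ + 1 - 0).toNat * 2 * 5 : ℕ) : ℝ) := by
      exact_mod_cast hcover
    push_cast at h2
    have h3 := Int.floor_le p⁻¹
    have h4 : 1 ≤ p⁻¹ := (one_le_inv₀ hp).2 hp1
    linarith
  · intro x hx
    obtain ⟨hx0, hx1⟩ := hA hx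
    have h1 : ⌊x / p⌋ * p ≤ x := (le_div_iff₀ hp).1 (Int.floor_le _)
    have h2 : x ≤ (⌊x / p⌋ + 1) * p := (div_le_iff₀ hp).1 (Int.lt_floor_add_one _).le
    have h3 : ⌊x / p⌋ ∈ Finset.Icc (0 : ℤ) ⌊p⁻¹⌋ := by
      refine Finset.mem_Icc.2 ⟨Int.floor_nonneg.2 (by positivity), Int.floor_mono ?_⟩
      rw [div_eq_mul_inv]
      exact mul_le_of_le_one_left (by positivity) hx1
    rcases le_total x (c ⌊x / p⌋) with h | h
    · exact ⟨(⌊x / p⌋, true), by simpa using h3, by simpa using ⟨h1, h⟩⟩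
    · exact ⟨(⌊x / p⌋, false), by simpa using h3, by simpa using ⟨h, h2⟩⟩
  · rintro ⟨k, b⟩ x ⟨hxA, hx⟩ y ⟨hyA, hy⟩ hxy
    cases b
    · simp only [Bool.false_eq_true, if_false] at hx hy
      linarith [hx.1, hy.2, hc k]
    · simp only [if_true] at hx hy
      have h1 := hcφ k x hx y hy
      have h2 := hmono hxA hyA hxy.le
      have h3 := (abs_le.1 (hh x hxA)).1
      have h4 := (abs_le.1 (hh y hyA)).2
      have h5 := (abs_le.1 (hu y x)).2
      rw [abs_of_pos (sub_pos.2 hxy)] at h5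
      linarith

/-- Near every `g` in the Hölder space there is an `f`, a neighbourhood of which consists of functions
whose monotone sets have grid count at most `20 * 2 ^ (ℓ * γ)` at a common arbitrarily fine
scale `2 ^ (-ℓ)`. -/
lemma exists_dist_lt_gridCount_le {α γ : ℝ} (hα0 : 0 ≤ α) (hαγ : α < γ) (hγ1 : γ < 1)
    {g : C(Icc (0 : ℝ) 1, ℝ)} (hg : g ∈ HolderSet α) {ε : ℝ} (hε : 0 < ε) (n : ℕ) :
    ∃ f ∈ HolderSet α, dist f g < ε ∧ ∃ δ > 0, ∃ ℓ ≥ n, ∀ h : C(Icc (0 : ℝ) 1, ℝ), dist h f < δ →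
      ∀ A ⊆ Icc (0 : ℝ) 1, MonotoneOn (IccExtend zero_le_one ⇑h) A →
        (gridCount ℓ A : ℝ) ≤ 20 * (2 : ℝ) ^ (ℓ * γ) := by
  set G : ℝ → ℝ := IccExtend zero_le_one ⇑g with hG
  have hGB : ∀ x, |G x| ≤ ‖g‖ := fun x => g.norm_coe_le_norm _
  have hGu : UniformContinuous G :=
    (CompactSpace.uniformContinuous_of_continuous g.continuous).comp
      (LipschitzWith.projIcc zero_le_one).uniformContinuous
  obtain ⟨L, hL, u, huL, huG, huinc⟩ := exists_lipschitz_approx G ‖g‖ hGB hGu (ε / 4) (by positivity)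
  obtain ⟨e, he0, he1, he⟩ : ∃ e > 0, e ≤ 1 ∧ e * (‖g‖ + ε / 4 + 1) ≤ ε / 4 := by
    have hpos : 0 < ‖g‖ + ε / 4 + 1 := by positivity
    refine ⟨ε / 4 / (‖g‖ + ε / 4 + 1), by positivity, ?_, (div_mul_cancel₀ _ hpos.ne').le⟩
    rw [div_le_one hpos]
    linarith [norm_nonneg g]
  set v : ℝ → ℝ := fun x => (1 - e) * u x with hv
  have hvL : ∀ x y, |v x - v y| ≤ L * |x - y| := by
    intro x y
    simp only [hv, ← mul_sub, abs_mul, abs_of_nonneg (sub_nonneg.2 he1)]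
    exact (mul_le_of_le_one_left (abs_nonneg _) (by linarith)).trans (huL x y)
  obtain ⟨ℓ, hℓn, hℓ⟩ : ∃ ℓ ≥ n, (L + 1) * (2 : ℝ) ^ (-((γ - α) * ℓ)) ≤ e := by
    have h1 : Filter.Tendsto (fun ℓ : ℕ => (L + 1) * (2 : ℝ) ^ (-((γ - α) * ℓ)))
        Filter.atTop (nhds ((L + 1) * 0)) := by
      refine Filter.Tendsto.const_mul _ ?_
      refine (tendsto_rpow_atBot_of_base_gt_one 2 (by norm_num)).comp ?_
      refine Filter.tendsto_neg_atTop_atBot.comp ?_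
      exact tendsto_natCast_atTop_atTop.const_mul_atTop (sub_pos.2 hαγ)
    rw [mul_zero] at h1
    obtain ⟨ℓ, h2, h3⟩ := ((h1.eventually (ge_mem_nhds he0)).and
      (Filter.eventually_ge_atTop n)).exists
    exact ⟨ℓ, h3, h2⟩
  set τ : ℝ := ((2 : ℝ) ^ ℓ)⁻¹ with hτdef
  have hτr : τ = (2 : ℝ) ^ (-(ℓ : ℝ)) := by
    rw [Real.rpow_neg (by norm_num), Real.rpow_natCast]
  have hτ : 0 < τ := by positivity
  set p : ℝ := (2 : ℝ) ^ (-(ℓ * γ)) with hpdef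
  have hp : 0 < p := by positivity
  have hp1 : p ≤ 1 := Real.rpow_le_one_of_one_le_of_nonpos (by norm_num)
    (neg_nonpos.2 (mul_nonneg (Nat.cast_nonneg _) (hα0.trans hαγ.le)))
  have hτp : τ ≤ p := by
    rw [hτr]
    refine Real.rpow_le_rpow_of_exponent_le (by norm_num) (neg_le_neg ?_)
    exact mul_le_of_le_one_right (Nat.cast_nonneg _) hγ1.le
  have hamp : (L + 1) * p ≤ e * τ ^ α := by
    have h1 : p = (2 : ℝ) ^ (-((γ - α) * ℓ)) * τ ^ α := by
      rw [hτr, ← Real.rpow_mul (by norm_num), ← Real.rpow_add (by norm_num)]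
      rw [hpdef]
      congr 1
      ring
    rw [h1, ← mul_assoc]
    exact mul_le_mul_of_nonneg_right hℓ (by positivity)
  obtain ⟨φ, hφ, hφlip, hφdec⟩ := exists_oscillation (M := L + 1) (by linarith) hp hτ hτp
  have hφhol : ∀ x y, |φ x - φ y| ≤ e * |x - y| ^ α := by
    intro x y
    have h1 : |φ x - φ y| ≤ (L + 1) * p * min 1 (|x - y| / τ) := by
      rw [mul_min_of_nonneg _ _ (by positivity), mul_one]
      refine le_min ?_ (hφlip x y)
      exact abs_le.2 ⟨by linarith [hφ x, hφ y], by linarith [hφ x, hφ y]⟩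
    calc |φ x - φ y| ≤ (L + 1) * p * (|x - y| / τ) ^ α :=
          h1.trans (mul_le_mul_of_nonneg_left (min_one_le_rpow hα0 (hαγ.trans hγ1).le
            (by positivity)) (by positivity))
      _ ≤ e * τ ^ α * (|x - y| / τ) ^ α := mul_le_mul_of_nonneg_right hamp (by positivity)
      _ = e * |x - y| ^ α := by
          rw [mul_assoc, ← Real.mul_rpow hτ.le (by positivity), mul_div_cancel₀ _ hτ.ne']
  have hφe : ∀ x, φ x ≤ e := by
    intro x
    have h1 : τ ^ α ≤ 1 := Real.rpow_le_one hτ.le (hτp.trans hp1) hα0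
    exact (hφ x).2.trans (hamp.trans (mul_le_of_le_one_right he0.le h1))
  have hvc : Continuous v := (LipschitzWith.of_dist_le_mul (K := ⟨L, hL.le⟩)
    fun x y => by simp only [Real.dist_eq]; exact hvL x y).continuous
  have hφc : Continuous φ := (LipschitzWith.of_dist_le_mul (K := ⟨(L + 1) * p / τ, by positivity⟩)
    fun x y => by
      simp only [Real.dist_eq]
      exact (hφlip x y).trans_eq (mul_div_left_comm _ _ _ |>.trans (mul_comm _ _))).continuous
  refine ⟨⟨fun x => v x + φ x, by fun_prop⟩, ?_, ?_, τ / 2, by positivity, ℓ, hℓn, ?_⟩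
  · refine hg.imp id fun hgh x y => ?_
    have h1 : |u x - u y| ≤ |(x : ℝ) - y| ^ α := by
      refine huinc x y _ fun t => (hgh _ _).trans (Real.rpow_le_rpow (abs_nonneg _) ?_ hα0)
      have := (LipschitzWith.projIcc (zero_le_one (α := ℝ))).dist_le_mul (x + t) (y + t)
      simpa [Subtype.dist_eq, Real.dist_eq] using this
    have h2 : |v x - v y| ≤ (1 - e) * |(x : ℝ) - y| ^ α := by
      simp only [hv, ← mul_sub, abs_mul, abs_of_nonneg (sub_nonneg.2 he1)]
      exact mul_le_mul_of_nonneg_left h1 (by linarith)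
    have h3 := hφhol x y
    have h4 := abs_add_le (v x - v y) (φ x - φ y)
    simp only [ContinuousMap.coe_mk]
    rw [show v x + φ x - (v y + φ y) = v x - v y + (φ x - φ y) by ring]
    linarith
  · refine ((ContinuousMap.dist_le (C := ε / 2) (by positivity)).2 fun x => ?_).trans_lt (by linarith)
    have h1 : G x = g x := IccExtend_val _ _ _
    have h2 := abs_le.1 (huG x)
    have h3 := abs_le.1 (hGB x)
    have h4 := hφe x
    have h5 := (hφ x).1
    rw [h1] at h2 h3
    rw [Real.dist_eq]
    simp only [ContinuousMap.coe_mk, hv]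
    have h6 : e * u x ≤ e * (‖g‖ + ε / 4) := mul_le_mul_of_nonneg_left (by linarith) he0.le
    have h7 : e * -(‖g‖ + ε / 4) ≤ e * u x := mul_le_mul_of_nonneg_left (by linarith) he0.le
    exact abs_le.2 ⟨by nlinarith, by nlinarith⟩
  · intro h hh A hA hmono
    have h1 := gridCount_le_of_monotoneOn hp hp1 ℓ hvL hφdec hA (fun x hx => ?_) hmono
    · rwa [hpdef, Real.rpow_neg (by norm_num), inv_inv] at h1
    · have h2 := (ContinuousMap.dist_apply_le_dist ⟨x, hA hx⟩).trans hh.le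
      rw [IccExtend_of_mem _ _ (hA hx)]
      simpa [Real.dist_eq] using h2

lemma lowerMinkowskiDim_le_of_frequently {α C : ℝ} (hα0 : 0 ≤ α) {A : Set ℝ}
    (h : ∀ d > α, ∃ᶠ ℓ : ℕ in Filter.atTop, (gridCount ℓ A : ℝ) ≤ C * (2 : ℝ) ^ (ℓ * d)) :
    lowerMinkowskiDim A ≤ α := by
  have hlog2 : 0 < Real.log 2 := Real.log_pos (by norm_num)
  refine le_of_forall_gt_imp_ge_of_dense fun d hd => ?_
  obtain ⟨d', hd', hd'd⟩ := exists_between hd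
  have hlim : Filter.Tendsto (fun ℓ : ℕ => (2 : ℝ) ^ ((d - d') * ℓ)) Filter.atTop Filter.atTop := by
    refine (tendsto_rpow_atTop_of_base_gt_one 2 (by norm_num)).comp ?_
    exact tendsto_natCast_atTop_atTop.const_mul_atTop (sub_pos.2 hd'd)
  refine Filter.liminf_le_of_frequently_le (((h d' hd').and_eventually
    ((hlim.eventually_ge_atTop C).and (Filter.eventually_gt_atTop 0))).mono ?_) ?_
  · rintro ℓ ⟨h1, h2, h3⟩
    have hℓ : (0 : ℝ) < ℓ := by exact_mod_cast h3
    rw [div_le_iff₀ (by positivity)]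
    have h4 : (gridCount ℓ A : ℝ) ≤ (2 : ℝ) ^ (ℓ * d) := by
      refine h1.trans ((mul_le_mul_of_nonneg_right h2 (by positivity)).trans_eq ?_)
      rw [← Real.rpow_add (by norm_num)]
      congr 1
      ring
    rcases Nat.eq_zero_or_pos (gridCount ℓ A) with h0 | h0
    · rw [h0, Nat.cast_zero, Real.log_zero]
      have : 0 < d := hα0.trans_lt hd
      positivity
    · refine (Real.log_le_log (by exact_mod_cast h0) h4).trans_eq ?_
      rw [Real.log_rpow (by norm_num)]
      ring
  · refine Filter.isBoundedUnder_of ⟨0, fun ℓ => ?_⟩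
    exact div_nonneg (Real.log_natCast_nonneg _) (by positivity)

lemma dimH_le_of_frequently {α C : ℝ} {A : Set ℝ} (hA : A ⊆ Icc 0 1)
    (h : ∀ d > α, ∃ᶠ ℓ : ℕ in Filter.atTop, (gridCount ℓ A : ℝ) ≤ C * (2 : ℝ) ^ (ℓ * d)) :
    dimH A ≤ ENNReal.ofReal α := by
  refine dimH_le fun d hd => ?_
  by_contra! hlt
  have hαd : α < d := by
    rw [← ENNReal.ofReal_coe_nnreal] at hlt
    exact (ENNReal.ofReal_lt_ofReal_iff'.1 hlt).1
  set J : ℕ → Set ℤ := fun ℓ =>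
    {j : ℤ | (A ∩ Icc (((j : ℝ) - 1) / 2 ^ ℓ) ((j : ℝ) / 2 ^ ℓ)).Nonempty} with hJ
  have hfin : ∀ ℓ, (J ℓ).Finite := finite_gridIndices hA
  have : ∀ ℓ, Fintype (J ℓ) := fun ℓ => (hfin ℓ).fintype
  set t : ∀ ℓ : ℕ, J ℓ → Set ℝ := fun ℓ j => Icc (((j : ℤ) - 1 : ℝ) / 2 ^ ℓ) ((j : ℤ) / 2 ^ ℓ) with ht
  have hdiam : ∀ ℓ (j : J ℓ), Metric.ediam (t ℓ j) = ENNReal.ofReal ((2 ^ ℓ)⁻¹) := by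
    intro ℓ j
    simp only [ht, Real.ediam_Icc]
    congr 1
    ring
  have hr : Filter.Tendsto (fun ℓ : ℕ => ENNReal.ofReal (((2 : ℝ) ^ ℓ)⁻¹)) Filter.atTop (nhds 0) := by
    rw [← ENNReal.ofReal_zero]
    refine ENNReal.tendsto_ofReal ?_
    exact tendsto_inv_atTop_zero.comp (tendsto_pow_atTop_atTop_of_one_lt (by norm_num))
  have hcov : ∀ ℓ, A ⊆ ⋃ j, t ℓ j := by
    intro ℓ x hx
    have h2 : (0 : ℝ) < 2 ^ ℓ := by positivity
    have hmem : x ∈ Icc (((⌈x * 2 ^ ℓ⌉ : ℝ) - 1) / 2 ^ ℓ) ((⌈x * 2 ^ ℓ⌉ : ℝ) / 2 ^ ℓ) := by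
      refine ⟨(div_le_iff₀ h2).2 ?_, (le_div_iff₀ h2).2 (Int.le_ceil _)⟩
      linarith [Int.ceil_lt_add_one (x * 2 ^ ℓ)]
    exact mem_iUnion.2 ⟨⟨⌈x * 2 ^ ℓ⌉, x, hx, hmem⟩, hmem⟩
  have hle := Measure.hausdorffMeasure_le_liminf_sum (d : ℝ) A _ hr t
    (Filter.Eventually.of_forall fun ℓ j => (hdiam ℓ j).le) (Filter.Eventually.of_forall hcov)
  have hbound : Filter.liminf (fun ℓ => ∑ j, Metric.ediam (t ℓ j) ^ (d : ℝ)) Filter.atTop ≤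
      ENNReal.ofReal C := by
    refine Filter.liminf_le_of_frequently_le' ((h d hαd).mono fun ℓ hℓ => ?_)
    have hcard : Fintype.card (J ℓ) = gridCount ℓ A := by
      rw [← Nat.card_eq_fintype_card]
      rfl
    simp only [hdiam, Finset.sum_const, Finset.card_univ, hcard, nsmul_eq_mul]
    rw [ENNReal.ofReal_rpow_of_pos (by positivity), ← ENNReal.ofReal_natCast,
      ← ENNReal.ofReal_mul (by positivity)]
    refine ENNReal.ofReal_le_ofReal ?_
    refine (mul_le_mul_of_nonneg_right hℓ (by positivity)).trans_eq ?_
    rw [Real.inv_rpow (by positivity), Real.rpow_mul (by norm_num), Real.rpow_natCast,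
      mul_assoc, mul_inv_cancel₀ (by positivity), mul_one]
  rw [hd] at hle
  exact absurd (hle.trans hbound) (by simp)

theorem generic_holder_monotone_restriction_small (α : ℝ) (hα0 : 0 ≤ α) (hα1 : α < 1) :
    ∃ G : Set (HolderSet α), Dense G ∧ IsGδ G ∧
      ∀ f ∈ G, ∀ A ⊆ Icc (0:ℝ) 1,
        (MonotoneOn (Set.IccExtend zero_le_one ⇑f.1) A ∨
         AntitoneOn (Set.IccExtend zero_le_one ⇑f.1) A) →
        lowerMinkowskiDim A ≤ α ∧ dimH A ≤ ENNReal.ofReal α := by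
  have : CompleteSpace (HolderSet α) := (isClosed_holderSet α).completeSpace_coe
  obtain ⟨γ, -, hγα, hγ⟩ := exists_seq_strictAnti_tendsto' hα1
  set P : ℕ → Set (HolderSet α) := fun n => {f | ∃ ℓ ≥ n, ∀ A ⊆ Icc (0 : ℝ) 1,
    MonotoneOn (IccExtend zero_le_one ⇑f.1) A →
      (gridCount ℓ A : ℝ) ≤ 20 * (2 : ℝ) ^ (ℓ * γ n)} with hP
  set N : ℕ → Set (HolderSet α) := fun n => {f | ∃ ℓ ≥ n, ∀ A ⊆ Icc (0 : ℝ) 1,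
    AntitoneOn (IccExtend zero_le_one ⇑f.1) A →
      (gridCount ℓ A : ℝ) ≤ 20 * (2 : ℝ) ^ (ℓ * γ n)} with hN
  have hPd : ∀ n, Dense (interior (P n)) := by
    intro n
    refine Metric.dense_iff.2 fun g ε hε => ?_
    obtain ⟨f, hf, hfg, δ, hδ, ℓ, hℓ, H⟩ :=
      exists_dist_lt_gridCount_le hα0 (hγα n).1 (hγα n).2 g.2 hε n
    refine ⟨⟨f, hf⟩, hfg, mem_interior_iff_mem_nhds.2 (Metric.mem_nhds_iff.2 ⟨δ, hδ, ?_⟩)⟩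
    exact fun h hh => ⟨ℓ, hℓ, H h hh⟩
  have hNd : ∀ n, Dense (interior (N n)) := by
    intro n
    refine Metric.dense_iff.2 fun g ε hε => ?_
    obtain ⟨f, hf, hfg, δ, hδ, ℓ, hℓ, H⟩ :=
      exists_dist_lt_gridCount_le hα0 (hγα n).1 (hγα n).2 (neg_mem_holderSet g.2) hε n
    refine ⟨⟨-f, neg_mem_holderSet hf⟩, ?_,
      mem_interior_iff_mem_nhds.2 (Metric.mem_nhds_iff.2 ⟨δ, hδ, ?_⟩)⟩
    · rw [Metric.mem_ball, Subtype.dist_eq, ← dist_neg_neg, neg_neg]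
      exact hfg
    · intro h hh
      refine ⟨ℓ, hℓ, fun A hA hanti => H (-h.1) ?_ A hA hanti.neg⟩
      rw [Metric.mem_ball, Subtype.dist_eq] at hh
      rwa [← dist_neg_neg, neg_neg]
  have hfreq : ∀ A : Set ℝ, (∀ n, ∃ ℓ ≥ n, (gridCount ℓ A : ℝ) ≤ 20 * (2 : ℝ) ^ (ℓ * γ n)) →
      ∀ d > α, ∃ᶠ ℓ : ℕ in Filter.atTop, (gridCount ℓ A : ℝ) ≤ 20 * (2 : ℝ) ^ (ℓ * d) := by
    intro A h d hd
    refine Filter.frequently_atTop.2 fun m => ?_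
    obtain ⟨n, hn, hnm⟩ := ((hγ.eventually (ge_mem_nhds hd)).and
      (Filter.eventually_ge_atTop m)).exists
    obtain ⟨ℓ, hℓ, hc⟩ := h n
    refine ⟨ℓ, hnm.trans hℓ, hc.trans ?_⟩
    gcongr
    norm_num
  refine ⟨(⋂ n, interior (P n)) ∩ ⋂ n, interior (N n), ?_, ?_, ?_⟩
  · exact (dense_iInter_of_isOpen (fun _ => isOpen_interior) hPd).inter_of_Gδ
      (.iInter_of_isOpen fun _ => isOpen_interior) (.iInter_of_isOpen fun _ => isOpen_interior)
      (dense_iInter_of_isOpen (fun _ => isOpen_interior) hNd)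
  · exact (IsGδ.iInter_of_isOpen fun _ => isOpen_interior).inter
      (.iInter_of_isOpen fun _ => isOpen_interior)
  · rintro f ⟨hfP, hfN⟩ A hA hmono
    have h : ∀ n, ∃ ℓ ≥ n, (gridCount ℓ A : ℝ) ≤ 20 * (2 : ℝ) ^ (ℓ * γ n) := by
      intro n
      rcases hmono with hm | hm
      · obtain ⟨ℓ, hℓ, H⟩ := interior_subset (mem_iInter.1 hfP n)
        exact ⟨ℓ, hℓ, H A hA hm⟩
      · obtain ⟨ℓ, hℓ, H⟩ := interior_subset (mem_iInter.1 hfN n)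
        exact ⟨ℓ, hℓ, H A hA hm⟩
    exact ⟨lowerMinkowskiDim_le_of_frequently hα0 (hfreq A h),
      dimH_le_of_frequently hA (hfreq A h)⟩
end

section
/- Suppose 0 ≤ α < 2. There exists a dense G_δ set G in C₁^α[0,1] such that for every f ∈ G there exists a closed set A ⊆ [0,1] on which f is convex and whose upper Minkowski dimension equals 1. -/
open Set MeasureTheory

/-- The space `C₁^{1+β}[0,1]`: pairs `(g, g')` where `g'` is the derivative of `g`
on `[0,1]` and `|g' x - g' y| ≤ |x-y|^β` (just `C¹[0,1]` when `β = 0`); the product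
metric is exactly the `C¹` metric `max (‖g-h‖_∞) (‖g'-h'‖_∞)`. -/
def C1HolderSet (β : ℝ) : Set (C(Icc (0:ℝ) 1, ℝ) × C(Icc (0:ℝ) 1, ℝ)) :=
  {p | (∀ x : Icc (0:ℝ) 1,
          HasDerivWithinAt (Set.IccExtend zero_le_one ⇑p.1) (p.2 x) (Icc 0 1) (x : ℝ)) ∧
       (β = 0 ∨ ∀ x y : Icc (0:ℝ) 1, |p.2 x - p.2 y| ≤ |(x : ℝ) - (y : ℝ)| ^ β)}

/-- `f` is convex on the set `A`: all second divided differences over triples of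
points of `A` are nonnegative. -/
def ConvexOnSet (f : ℝ → ℝ) (A : Set ℝ) : Prop :=
  ∀ x₁ ∈ A, ∀ x₂ ∈ A, ∀ x₃ ∈ A, x₁ < x₂ → x₂ < x₃ →
    0 ≤ ((f x₃ - f x₂) / (x₃ - x₂) - (f x₂ - f x₁) / (x₂ - x₁)) / (x₃ - x₁)

/-- Number of decimal grid intervals `[(j-1)/10^ℓ, j/10^ℓ]` meeting `A`. -/
noncomputable def gridCount10 (ℓ : ℕ) (A : Set ℝ) : ℕ :=
  Set.ncard {j : ℤ | (A ∩ Icc (((j : ℝ) - 1) / 10 ^ ℓ) ((j : ℝ) / 10 ^ ℓ)).Nonempty}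

/-- Upper Minkowski (box) dimension via decimal grid counts. -/
noncomputable def upperMinkowskiDim (A : Set ℝ) : ℝ :=
  Filter.limsup (fun ℓ : ℕ => Real.log (gridCount10 ℓ A) / (ℓ * Real.log 10)) Filter.atTop

/-- The first `10 ^ (n * m)` positive points of the decimal grid of mesh `10 ^ (-(n + 1) * m)`. -/
noncomputable def gridCluster (n m : ℕ) : Finset ℝ :=
  (Finset.Icc 1 (10 ^ (n * m))).image fun j : ℕ => (j : ℝ) / 10 ^ ((n + 1) * m)

/-- Every point of the cluster admits a strict supporting line of slope in `(0, 1 / (n + 1))`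
with respect to the cluster and the origin, and lies above the value at the origin. -/
def SupportedOnCluster (g : ℝ → ℝ) (n m : ℕ) : Prop :=
  ∀ a ∈ gridCluster n m, g 0 < g a ∧ ∃ s : ℝ, (0 < s ∧ s < 1 / (n + 1)) ∧
    ∀ b ∈ insert 0 (gridCluster n m), b ≠ a → g a + s * (b - a) < g b

/-- To the right of the origin `g` is increasing and strictly convex, with vanishing slope. -/
def ConvexGerm (g : ℝ → ℝ) : Prop :=
  ∀ ε > 0, ∃ δ > 0, ∀ a, 0 < a → a ≤ δ → g 0 < g a ∧ ∃ s : ℝ, (0 < s ∧ s < ε) ∧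
    ∀ b, 0 ≤ b → b ≤ δ → b ≠ a → g a + s * (b - a) < g b

lemma gridCluster_pos {n m : ℕ} {a : ℝ} (ha : a ∈ gridCluster n m) : 0 < a := by
  simp only [gridCluster, Finset.mem_image, Finset.mem_Icc] at ha
  obtain ⟨j, ⟨hj, -⟩, rfl⟩ := ha
  have : (0 : ℝ) < j := by exact_mod_cast hj
  positivity

lemma gridCluster_le_pow {n m : ℕ} {a : ℝ} (ha : a ∈ gridCluster n m) : a ≤ 1 / 10 ^ m := by
  simp only [gridCluster, Finset.mem_image, Finset.mem_Icc] at ha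
  obtain ⟨j, ⟨-, hj⟩, rfl⟩ := ha
  have h : (j : ℝ) ≤ 10 ^ (n * m) := by exact_mod_cast hj
  rw [div_le_div_iff₀ (by positivity) (by positivity), one_mul, add_mul, one_mul, pow_add]
  gcongr

lemma one_div_ten_pow_le (m : ℕ) : (1 : ℝ) / 10 ^ m ≤ 1 / (m + 1) := by
  have h : ((m + 1 : ℕ) : ℝ) ≤ ((10 ^ m : ℕ) : ℝ) :=
    Nat.cast_le.2 (Nat.lt_pow_self (by norm_num))
  push_cast at h
  gcongr

lemma gridCluster_le {n m : ℕ} {a : ℝ} (ha : a ∈ gridCluster n m) : a ≤ 1 / (m + 1) :=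
  (gridCluster_le_pow ha).trans (one_div_ten_pow_le m)

lemma gridCluster_le_one {n m : ℕ} {a : ℝ} (ha : a ∈ gridCluster n m) : a ≤ 1 := by
  refine (gridCluster_le ha).trans ?_
  rw [div_le_one (by positivity)]
  linarith [m.cast_nonneg (α := ℝ)]

lemma ConvexGerm.exists_supportedOnCluster {g : ℝ → ℝ} (hg : ConvexGerm g) (n : ℕ) :
    ∃ m > n, SupportedOnCluster g n m := by
  obtain ⟨δ, hδ, h⟩ := hg (1 / (n + 1)) (by positivity)
  obtain ⟨k, hk⟩ := exists_nat_one_div_lt hδ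
  have hkn : (1 : ℝ) / ((k + n + 1 : ℕ) + 1) ≤ 1 / (k + 1) := by
    gcongr
    linarith [n.cast_nonneg (α := ℝ)]
  have hle : ∀ a ∈ gridCluster n (k + n + 1), a ≤ δ := fun a ha => by
    linarith [gridCluster_le ha]
  refine ⟨k + n + 1, by omega, fun a ha => ?_⟩
  obtain ⟨h0, s, hs, hb⟩ := h a (gridCluster_pos ha) (hle a ha)
  refine ⟨h0, s, hs, fun b hb' hne => ?_⟩
  rcases Finset.mem_insert.1 hb' with rfl | hb'
  · exact hb 0 le_rfl hδ.le hne
  · exact hb b (gridCluster_pos hb').le (hle b hb') hne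

lemma isOpen_setOf_supportedOnCluster {X : Type*} [TopologicalSpace X] {F : X → ℝ → ℝ}
    (hF : ∀ t, Continuous fun x => F x t) (n m : ℕ) :
    IsOpen {x | SupportedOnCluster (F x) n m} := by
  simp only [SupportedOnCluster, ofPred_forall, ofPred_and, ofPred_exists]
  refine isOpen_biInter_finset fun a _ => (isOpen_lt (hF 0) (hF a)).inter <|
    isOpen_iUnion fun s => (isOpen_const.inter isOpen_const).inter <| isOpen_biInter_finset fun b _ =>
      isOpen_iInter_of_finite fun _ => isOpen_lt ((hF a).add (continuous_const (y := s * (b - a)))) (hF b)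

lemma convexOnSet_of_support {g : ℝ → ℝ} {A : Set ℝ}
    (h : ∀ a ∈ A, (∃ x ∈ A, x < a) → ∃ s : ℝ, ∀ b ∈ A, g a + s * (b - a) ≤ g b) :
    ConvexOnSet g A := by
  intro x hx y hy z hz hxy hyz
  obtain ⟨s, hs⟩ := h y hy ⟨x, hx, hxy⟩
  have h1 := hs x hx
  have h2 := hs z hz
  have h3 : s ≤ (g z - g y) / (z - y) := by
    rw [le_div_iff₀ (by linarith)]; linarith
  have h4 : (g y - g x) / (y - x) ≤ s := by
    rw [div_le_iff₀ (by linarith)]; linarith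
  exact div_nonneg (by linarith) (by linarith)

lemma ConvexOnSet.of_sub_linear {f : ℝ → ℝ} {A : Set ℝ} (c : ℝ)
    (h : ConvexOnSet (fun t => f t - c * t) A) : ConvexOnSet f A := by
  intro x hx y hy z hz hxy hyz
  convert h x hx y hy z hz hxy hyz using 2
  have h1 : y - x ≠ 0 := by linarith
  have h2 : z - y ≠ 0 := by linarith
  field_simp
  ring

lemma gridIndices_subset_Icc {A : Set ℝ} (hA : A ⊆ Icc 0 1) (ℓ : ℕ) :
    {j : ℤ | (A ∩ Icc (((j : ℝ) - 1) / 10 ^ ℓ) ((j : ℝ) / 10 ^ ℓ)).Nonempty} ⊆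
      (Finset.Icc (0 : ℤ) (10 ^ ℓ + 1) : Set ℤ) := by
  rintro j ⟨x, hx, h1, h2⟩
  obtain ⟨h3, h4⟩ := hA hx
  rw [div_le_iff₀ (by positivity)] at h1
  rw [le_div_iff₀ (by positivity)] at h2
  have hp : (0 : ℝ) < 10 ^ ℓ := by positivity
  have h5 : (0 : ℝ) ≤ j := by nlinarith
  have h6 : (j : ℝ) ≤ 10 ^ ℓ + 1 := by nlinarith
  rw [Finset.coe_Icc]
  exact ⟨by exact_mod_cast h5, by exact_mod_cast h6⟩

lemma gridCount10_le {A : Set ℝ} (hA : A ⊆ Icc 0 1) (ℓ : ℕ) :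
    gridCount10 ℓ A ≤ 3 * 10 ^ ℓ := by
  have h := Set.ncard_le_ncard (gridIndices_subset_Icc hA ℓ) (Finset.finite_toSet _)
  rw [Set.ncard_coe_finset, Int.card_Icc] at h
  have h1 : 1 ≤ 10 ^ ℓ := Nat.one_le_pow _ _ (by norm_num)
  have h2 : (10 ^ ℓ + 1 + 1 - 0 : ℤ).toNat = 10 ^ ℓ + 2 := by
    rw [show (10 ^ ℓ + 1 + 1 - 0 : ℤ) = ((10 ^ ℓ + 2 : ℕ) : ℤ) by push_cast; ring]
    exact Int.toNat_natCast _
  unfold gridCount10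
  omega

lemma pow_le_gridCount10 {A : Set ℝ} (hA : A ⊆ Icc 0 1) {n m : ℕ}
    (h : (gridCluster n m : Set ℝ) ⊆ A) : 10 ^ (n * m) ≤ gridCount10 ((n + 1) * m) A := by
  have hsub : (((Finset.Icc 1 (10 ^ (n * m))).image ((↑) : ℕ → ℤ) : Finset ℤ) : Set ℤ) ⊆
      {j : ℤ | (A ∩ Icc (((j : ℝ) - 1) / 10 ^ ((n + 1) * m))
        ((j : ℝ) / 10 ^ ((n + 1) * m))).Nonempty} := by
    intro j hj
    simp only [Finset.coe_image, Set.mem_image, Finset.mem_coe] at hj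
    obtain ⟨i, hi, rfl⟩ := hj
    refine ⟨(i : ℝ) / 10 ^ ((n + 1) * m), h ?_, ?_, ?_⟩
    · exact Finset.mem_coe.2 (Finset.mem_image_of_mem _ hi)
    · push_cast
      gcongr
      linarith
    · simp
  have := Set.ncard_le_ncard hsub
    ((Finset.finite_toSet _).subset (gridIndices_subset_Icc hA _))
  rwa [Set.ncard_coe_finset, Finset.card_image_of_injective _ Nat.cast_injective,
    Nat.card_Icc, Nat.add_sub_cancel] at this

lemma upperMinkowskiDim_eq_one {A : Set ℝ} (hA : A ⊆ Icc 0 1)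
    (h : ∀ N, ∃ n ≥ N, ∃ m > n, (gridCluster n m : Set ℝ) ⊆ A) : upperMinkowskiDim A = 1 := by
  have hlog : 0 < Real.log 10 := Real.log_pos (by norm_num)
  set u : ℕ → ℝ := fun ℓ => Real.log (gridCount10 ℓ A) / (ℓ * Real.log 10) with hu
  set v : ℕ → ℝ := fun ℓ => 1 + Real.log 3 / Real.log 10 / ℓ with hv
  have hvt : Filter.Tendsto v Filter.atTop (nhds 1) := by
    simpa using (tendsto_const_div_atTop_nhds_zero_nat (Real.log 3 / Real.log 10)).const_add 1
  have huv : u ≤ᶠ[Filter.atTop] v := by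
    filter_upwards [Filter.eventually_gt_atTop 0] with ℓ hℓ
    have hℓ' : (0 : ℝ) < ℓ := by exact_mod_cast hℓ
    have hle : Real.log (gridCount10 ℓ A) ≤ Real.log 3 + ℓ * Real.log 10 := by
      rcases Nat.eq_zero_or_pos (gridCount10 ℓ A) with h0 | h0
      · rw [h0]
        simp only [CharP.cast_eq_zero, Real.log_zero]
        have : 0 < Real.log 3 := Real.log_pos (by norm_num)
        positivity
      · rw [← Real.log_pow, ← Real.log_mul (by norm_num) (by positivity)]
        apply Real.log_le_log (by exact_mod_cast h0)
        exact_mod_cast gridCount10_le hA ℓ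
    simp only [hu, hv]
    rw [div_le_iff₀ (by positivity)]
    refine hle.trans_eq ?_
    field_simp
    ring
  have hu0 : ∀ ℓ, 0 ≤ u ℓ := fun ℓ =>
    div_nonneg (Real.log_natCast_nonneg _) (by positivity)
  have hbdd : Filter.IsBoundedUnder (· ≤ ·) Filter.atTop u := hvt.isBoundedUnder_le.mono_le huv
  have hcob : Filter.IsCoboundedUnder (· ≤ ·) Filter.atTop u :=
    (Filter.isBoundedUnder_of ⟨0, hu0⟩ : Filter.IsBoundedUnder (· ≥ ·) _ u).isCoboundedUnder_le
  refine le_antisymm ?_ ?_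
  · exact (Filter.limsup_le_limsup huv hcob hvt.isBoundedUnder_le).trans_eq hvt.limsup_eq
  · refine le_of_forall_pos_sub_le fun ε hε => ?_
    obtain ⟨N, hN⟩ := exists_nat_one_div_lt hε
    refine Filter.le_limsup_of_frequently_le ?_ hbdd
    refine Filter.frequently_atTop.2 fun K => ?_
    obtain ⟨n, hn, m, hm, hsub⟩ := h (max N K)
    refine ⟨(n + 1) * m, ?_, ?_⟩
    · have : K ≤ n := (le_max_right _ _).trans hn
      nlinarith
    · have hm0 : (0 : ℝ) < m := by exact_mod_cast (Nat.zero_le n).trans_lt hm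
      have hNn : (1 : ℝ) / (n + 1) ≤ 1 / (N + 1) := by
        have : (N : ℝ) ≤ n := by exact_mod_cast (le_max_left _ _).trans hn
        gcongr
      have hcount : (n * m : ℕ) * Real.log 10 ≤ Real.log (gridCount10 ((n + 1) * m) A) := by
        rw [← Real.log_pow]
        refine Real.log_le_log (pow_pos (by norm_num) _) ?_
        exact_mod_cast pow_le_gridCount10 hA hsub
      have : (1 : ℝ) - 1 / (n + 1) ≤
          Real.log (gridCount10 ((n + 1) * m) A) / (((n + 1) * m : ℕ) * Real.log 10) := by
        rw [le_div_iff₀ (by push_cast; positivity)]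
        refine le_trans (le_of_eq ?_) hcount
        push_cast
        field_simp
        ring
      linarith

lemma exists_strictMono_of_eventually {r : ℕ → ℕ → Prop}
    (h : ∀ n, ∀ᶠ k in Filter.atTop, r n k) :
    ∃ φ : ℕ → ℕ, StrictMono φ ∧ ∀ i j, i < j → r (φ i) (φ j) := by
  choose N hN using fun n => Filter.eventually_atTop.1 (h n)
  let φ : ℕ → ℕ := fun k =>
    Nat.rec 0 (fun _ p => p + 1 + ∑ i ∈ Finset.range (p + 1), N i) k
  have hφ : ∀ k, φ (k + 1) = φ k + 1 + ∑ i ∈ Finset.range (φ k + 1), N i := fun _ => rfl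
  have hmono : StrictMono φ := strictMono_nat_of_lt_succ fun k => by rw [hφ]; omega
  refine ⟨φ, hmono, fun i j hij => hN _ _ ?_⟩
  obtain ⟨j, rfl⟩ : ∃ k, j = k + 1 := ⟨j - 1, by omega⟩
  have hi : φ i ≤ φ j := hmono.monotone (by omega)
  have := Finset.single_le_sum (f := N) (fun _ _ => Nat.zero_le _)
    (Finset.mem_range.2 (Nat.lt_add_one_of_le hi))
  rw [hφ]
  omega

lemma isClosed_insert_zero_iUnion {C : ℕ → Finset ℝ}
    (hC : ∀ k, ∀ a ∈ C k, 0 < a ∧ a ≤ 1 / ((k : ℝ) + 1)) :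
    IsClosed (insert (0 : ℝ) (⋃ k, (C k : Set ℝ))) := by
  rw [← isOpen_compl_iff, isOpen_iff_mem_nhds]
  intro x hx
  simp only [mem_compl_iff, mem_insert_iff, mem_iUnion, Finset.mem_coe, not_or, not_exists] at hx
  rcases lt_or_gt_of_ne hx.1 with h0 | h0
  · filter_upwards [Iio_mem_nhds h0] with y hy
    simp only [mem_compl_iff, mem_insert_iff, mem_iUnion, Finset.mem_coe, not_or, not_exists]
    exact ⟨ne_of_lt hy, fun k hk => absurd (hC k y hk).1 (not_lt.2 (le_of_lt hy))⟩
  · obtain ⟨K, hK⟩ := exists_nat_one_div_lt (half_pos h0)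
    have hopen : IsOpen (⋃ k ∈ Finset.range K, (C k : Set ℝ))ᶜ :=
      (isClosed_biUnion_finset fun k _ => (C k).finite_toSet.isClosed).isOpen_compl
    filter_upwards [Ioi_mem_nhds (half_lt_self h0),
      hopen.mem_nhds (by simpa using fun k _ => hx.2 k)] with y hy hy'
    simp only [mem_compl_iff, mem_insert_iff, mem_iUnion, Finset.mem_coe, not_or, not_exists]
    have hy0 : x / 2 < y := hy
    refine ⟨by linarith, fun k hk => ?_⟩
    rcases lt_or_ge k K with hkK | hkK
    · exact hy' (by simpa using ⟨k, hkK, hk⟩)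
    · have : (1 : ℝ) / (k + 1) ≤ 1 / (K + 1) := by
        have : (K : ℝ) ≤ k := by exact_mod_cast hkK
        gcongr
      linarith [(hC k y hk).2]

lemma exists_convexOnSet_of_supportedOnCluster {g : ℝ → ℝ} (hg : Continuous g)
    (h : ∀ n, ∃ m > n, SupportedOnCluster g n m) :
    ∃ A ⊆ Icc (0 : ℝ) 1, IsClosed A ∧ ConvexOnSet g A ∧ upperMinkowskiDim A = 1 := by
  choose m hm hsupp using h
  set C : ℕ → Finset ℝ := fun n => gridCluster n (m n) with hCdef
  have hpos : ∀ n, ∀ a ∈ C n, 0 < a := fun n a ha => gridCluster_pos ha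
  have hone : ∀ n, ∀ a ∈ C n, a ≤ 1 := fun n a ha => gridCluster_le_one ha
  have hle : ∀ n, ∀ a ∈ C n, a ≤ 1 / ((n : ℝ) + 1) := fun n a ha => by
    refine (gridCluster_le ha).trans ?_
    have : (n : ℝ) ≤ m n := by exact_mod_cast (hm n).le
    gcongr
  choose! h0 s hs hb using hsupp
  have hcompat : ∀ n, ∀ᶠ k in Filter.atTop, ∀ a ∈ C n, ∀ b ∈ C k,
      g a + s n a * (b - a) ≤ g b ∧ g b + s k b * (a - b) ≤ g a := by
    intro n
    refine (Filter.eventually_all_finset _).2 fun a ha => ?_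
    have h1 : g a + s n a * (0 - a) < g 0 :=
      hb n a ha 0 (Finset.mem_insert_self _ _) (hpos n a ha).ne
    have h2 : g 0 < (g 0 + g a) / 2 := by linarith [h0 n a ha]
    have hev : ∀ᶠ t in nhds (0 : ℝ), g a + s n a * (t - a) < g t ∧ g t < (g 0 + g a) / 2 :=
      ((by fun_prop : Continuous fun t => g a + s n a * (t - a)).continuousAt.eventually_lt
        hg.continuousAt h1).and (hg.continuousAt.eventually_lt_const h2)
    obtain ⟨δ, hδ, hball⟩ := Metric.eventually_nhds_iff.1 hev
    have hlim := tendsto_one_div_add_atTop_nhds_zero_nat (𝕜 := ℝ)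
    filter_upwards [hlim.eventually_lt_const hδ,
      hlim.eventually_lt_const (show 0 < (g a - g 0) / 2 by linarith)] with k hk1 hk2 b hbk
    have hb0 := hpos k b hbk
    have hbk' := hle k b hbk
    obtain ⟨h3, h4⟩ := hball (y := b) (by
      rw [Real.dist_eq, sub_zero, abs_of_pos hb0]; linarith)
    obtain ⟨h5, h6⟩ := hs k b hbk
    refine ⟨h3.le, ?_⟩
    have h7 : s k b * (a - b) ≤ s k b := by
      have := hone n a ha
      nlinarith
    linarith
  obtain ⟨φ, hφ, hr⟩ := exists_strictMono_of_eventually hcompat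
  have hA : insert (0 : ℝ) (⋃ k, (C (φ k) : Set ℝ)) ⊆ Icc 0 1 := by
    refine insert_subset ⟨le_rfl, zero_le_one⟩ (iUnion_subset fun k a ha => ?_)
    exact ⟨(hpos _ a ha).le, hone _ a ha⟩
  refine ⟨insert 0 (⋃ k, (C (φ k) : Set ℝ)), hA, ?_, ?_, ?_⟩
  · refine isClosed_insert_zero_iUnion fun k a ha => ⟨hpos _ a ha, (hle _ a ha).trans ?_⟩
    have : (k : ℝ) ≤ φ k := by exact_mod_cast hφ.le_apply
    gcongr
  · refine convexOnSet_of_support fun a ha hx => ?_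
    rcases ha with rfl | ha
    · obtain ⟨x, hxA, hx0⟩ := hx
      exact absurd (hA hxA).1 (not_le.2 hx0)
    obtain ⟨k, ha⟩ := mem_iUnion.1 ha
    refine ⟨s (φ k) a, fun b hbA => ?_⟩
    rcases eq_or_ne b a with rfl | hne
    · simp
    rcases hbA with rfl | hbA
    · exact (hb _ a ha 0 (Finset.mem_insert_self _ _) hne).le
    obtain ⟨i, hbi⟩ := mem_iUnion.1 hbA
    rcases lt_trichotomy i k with hik | rfl | hik
    · exact (hr i k hik b hbi a ha).2
    · exact (hb _ a ha b (Finset.mem_insert_of_mem hbi) hne).le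
    · exact (hr k i hik a ha b hbi).1
  · refine upperMinkowskiDim_eq_one hA fun N => ⟨φ N, hφ.le_apply, m (φ N), hm _, ?_⟩
    exact (subset_iUnion (fun k => (C (φ k) : Set ℝ)) N).trans (subset_insert _ _)

lemma exists_dense_Gδ_convexOnSet {X : Type*} [TopologicalSpace X] [BaireSpace X]
    {F : X → ℝ → ℝ} (hFx : ∀ x, Continuous (F x)) (hFt : ∀ t, Continuous fun x => F x t)
    (hD : Dense {x | ConvexGerm (F x)}) :
    ∃ G : Set X, Dense G ∧ IsGδ G ∧ ∀ x ∈ G, ∃ A ⊆ Icc (0 : ℝ) 1, IsClosed A ∧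
      ConvexOnSet (F x) A ∧ upperMinkowskiDim A = 1 := by
  have hopen : ∀ n : ℕ, IsOpen {x | ∃ m > n, SupportedOnCluster (F x) n m} := fun n => by
    simp only [ofPred_exists, ofPred_and]
    exact isOpen_iUnion fun m => isOpen_const.inter (isOpen_setOf_supportedOnCluster hFt n m)
  refine ⟨⋂ n : ℕ, {x | ∃ m > n, SupportedOnCluster (F x) n m},
    dense_iInter_of_isOpen_nat hopen fun n =>
      hD.mono fun x hx => ConvexGerm.exists_supportedOnCluster hx n,
    IsGδ.iInter_of_isOpen hopen, fun x hx => ?_⟩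
  exact exists_convexOnSet_of_supportedOnCluster (hFx x) (mem_iInter.1 hx)

lemma convexGerm_of_sq {g : ℝ → ℝ} {δ : ℝ} (hδ : 0 < δ)
    (h : ∀ t, 0 ≤ t → t ≤ δ → g t = g 0 + t ^ 2) : ConvexGerm g := by
  intro ε hε
  refine ⟨min δ (ε / 4), by positivity, fun a ha haδ => ?_⟩
  obtain ⟨h1, h2⟩ := le_min_iff.1 haδ
  refine ⟨by rw [h a ha.le h1]; linarith [sq_pos_of_pos ha], 2 * a,
    ⟨by linarith, by linarith⟩, fun b hb hbδ hne => ?_⟩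
  rw [h a ha.le h1, h b hb (le_min_iff.1 hbδ).1]
  nlinarith [sq_pos_of_ne_zero (sub_ne_zero.2 hne)]

lemma convexGerm_of_cube {g : ℝ → ℝ} {δ : ℝ} (hδ : 0 < δ)
    (h : ∀ t, 0 ≤ t → t ≤ δ → g t = g 0 + t ^ 3 / 3) : ConvexGerm g := by
  intro ε hε
  refine ⟨min δ (min 1 (ε / 2)), by positivity, fun a ha haδ => ?_⟩
  obtain ⟨h1, h2⟩ := le_min_iff.1 haδ
  obtain ⟨h3, h4⟩ := le_min_iff.1 h2
  refine ⟨by rw [h a ha.le h1]; linarith [pow_pos ha 3], a ^ 2,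
    ⟨by positivity, by nlinarith⟩, fun b hb hbδ hne => ?_⟩
  rw [h a ha.le h1, h b hb (le_min_iff.1 hbδ).1]
  nlinarith [mul_pos (sq_pos_of_ne_zero (sub_ne_zero.2 hne)) (by linarith : 0 < b + 2 * a)]

/-- Delay a function by `δ`, shrink it by `1 - 2 * δ` and add the germ `t ^ 2` on `[0, δ]`. -/
noncomputable def insertSquareGerm (h : C(Icc (0 : ℝ) 1, ℝ)) (δ : ℝ) : C(Icc (0 : ℝ) 1, ℝ) where
  toFun t := (1 - 2 * δ) * h (projIcc 0 1 zero_le_one (t - δ)) + min (t : ℝ) δ ^ 2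
  continuous_toFun := by
    have := continuous_projIcc (a := (0 : ℝ)) (h := zero_le_one)
    fun_prop

lemma insertSquareGerm_apply (h : C(Icc (0 : ℝ) 1, ℝ)) (δ : ℝ) (t : Icc (0 : ℝ) 1) :
    insertSquareGerm h δ t =
      (1 - 2 * δ) * h (projIcc 0 1 zero_le_one (t - δ)) + min (t : ℝ) δ ^ 2 := rfl

lemma insertSquareGerm_eq (h : C(Icc (0 : ℝ) 1, ℝ)) {δ : ℝ} (hδ : 0 ≤ δ) {t : Icc (0 : ℝ) 1}
    (ht : (t : ℝ) ≤ δ) : insertSquareGerm h δ t = insertSquareGerm h δ 0 + (t : ℝ) ^ 2 := by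
  simp only [insertSquareGerm_apply]
  rw [projIcc_of_le_left _ (by linarith : (t : ℝ) - δ ≤ 0),
    projIcc_of_le_left _ (by simpa using hδ), min_eq_left ht]
  simp [hδ]

lemma insertSquareGerm_mem_holderSet {α : ℝ} (hα0 : 0 ≤ α) (hα : α ≤ 1) {h : C(Icc (0 : ℝ) 1, ℝ)}
    (hh : h ∈ HolderSet α) {δ : ℝ} (hδ : 0 ≤ δ) (hδ' : δ ≤ 1 / 2) :
    insertSquareGerm h δ ∈ HolderSet α := by
  rcases eq_or_ne α 0 with h0 | h0
  · exact Or.inl h0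
  refine Or.inr fun x y => ?_
  rcases eq_or_ne x y with rfl | hxy
  · simp only [sub_self, abs_zero]
    positivity
  have hd : 0 < |(x : ℝ) - y| := abs_pos.2 (sub_ne_zero.2 (Subtype.coe_injective.ne hxy))
  have hd1 : |(x : ℝ) - y| ≤ 1 := by
    rw [abs_le]; constructor <;> linarith [x.2.1, x.2.2, y.2.1, y.2.2]
  have hle : |(x : ℝ) - y| ≤ |(x : ℝ) - y| ^ α := by
    simpa using Real.rpow_le_rpow_of_exponent_ge hd hd1 hα
  have hr : |h (projIcc 0 1 zero_le_one (x - δ)) - h (projIcc 0 1 zero_le_one (y - δ))| ≤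
      |(x : ℝ) - y| ^ α := by
    refine ((hh.resolve_left h0) _ _).trans (Real.rpow_le_rpow (abs_nonneg _) ?_ hα0)
    simpa using abs_projIcc_sub_projIcc (h := zero_le_one) (c := (x : ℝ) - δ) (d := y - δ)
  have hm : |min (x : ℝ) δ ^ 2 - min (y : ℝ) δ ^ 2| ≤ 2 * δ * |(x : ℝ) - y| := by
    have h1 : |min (x : ℝ) δ - min (y : ℝ) δ| ≤ |(x : ℝ) - y| := by
      simpa using abs_min_sub_min_le_max (x : ℝ) δ y δ
    have h2 : |min (x : ℝ) δ + min (y : ℝ) δ| ≤ 2 * δ := by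
      rw [abs_of_nonneg (add_nonneg (le_min x.2.1 hδ) (le_min y.2.1 hδ))]
      linarith [min_le_right (x : ℝ) δ, min_le_right (y : ℝ) δ]
    rw [sq_sub_sq, abs_mul]
    gcongr
  rw [insertSquareGerm_apply, insertSquareGerm_apply, add_sub_add_comm, ← mul_sub]
  refine (abs_add_le _ _).trans ?_
  rw [abs_mul, abs_of_nonneg (by linarith : 0 ≤ 1 - 2 * δ)]
  nlinarith

lemma dist_insertSquareGerm_lt (h : C(Icc (0 : ℝ) 1, ℝ)) {ε : ℝ} (hε : 0 < ε) :
    ∃ δ > 0, δ ≤ 1 / 2 ∧ dist (insertSquareGerm h δ) h < ε := by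
  obtain ⟨η, hη, hu⟩ := Metric.uniformContinuous_iff.1
    (CompactSpace.uniformContinuous_of_continuous h.continuous) (ε / 3) (by positivity)
  have hc : 0 < ε / (3 * (2 * ‖h‖ + 1)) := by positivity
  refine ⟨min (η / 2) (min (1 / 2) (ε / (3 * (2 * ‖h‖ + 1)))), by positivity,
    (min_le_right _ _).trans (min_le_left _ _), ?_⟩
  set δ := min (η / 2) (min (1 / 2) (ε / (3 * (2 * ‖h‖ + 1)))) with hδdef
  have hδ : 0 < δ := by positivity
  have h1 : δ < η := (min_le_left _ _).trans_lt (half_lt_self hη)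
  have h2 : δ ≤ 1 / 2 := (min_le_right _ _).trans (min_le_left _ _)
  have h3 : δ * (2 * ‖h‖ + 1) ≤ ε / 3 := by
    have : δ ≤ ε / (3 * (2 * ‖h‖ + 1)) := (min_le_right _ _).trans (min_le_right _ _)
    rw [le_div_iff₀ (by positivity)] at this
    linarith
  rw [ContinuousMap.dist_lt_iff hε]
  intro t
  set r := projIcc (0 : ℝ) 1 zero_le_one (t - δ) with hr
  have h4 : dist (h r) (h t) < ε / 3 := by
    refine hu ?_
    rw [hr]
    have : dist (projIcc (0 : ℝ) 1 zero_le_one (t - δ)) (projIcc 0 1 zero_le_one t) ≤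
        dist ((t : ℝ) - δ) t := by
      simpa [Subtype.dist_eq, Real.dist_eq] using
        abs_projIcc_sub_projIcc (h := zero_le_one) (c := (t : ℝ) - δ) (d := t)
    rw [projIcc_val] at this
    refine this.trans_lt ?_
    rwa [Real.dist_eq, sub_sub_cancel_left, abs_neg, abs_of_pos hδ]
  rw [Real.dist_eq, abs_lt] at h4 ⊢
  have h5 := abs_le.1 ((Real.norm_eq_abs _).symm.trans_le (h.norm_coe_le_norm r))
  rw [insertSquareGerm_apply, ← hr]
  have h6 : 0 ≤ min (t : ℝ) δ := le_min t.2.1 hδ.le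
  have h7 : min (t : ℝ) δ ≤ δ := min_le_right _ _
  have h8 : min (t : ℝ) δ ^ 2 ≤ δ := by nlinarith
  have h9 : 0 ≤ min (t : ℝ) δ ^ 2 := by positivity
  constructor <;> nlinarith

lemma exists_mem_holderSet_sq_germ {α : ℝ} (hα0 : 0 ≤ α) (hα : α ≤ 1) {h : C(Icc (0 : ℝ) 1, ℝ)}
    (hh : h ∈ HolderSet α) {ε : ℝ} (hε : 0 < ε) :
    ∃ k ∈ HolderSet α, dist k h < ε ∧ ∃ δ > 0, δ ≤ 1 ∧ ∀ t, 0 ≤ t → t ≤ δ →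
      IccExtend zero_le_one k t = k 0 + t ^ 2 := by
  obtain ⟨δ, hδ, hδ', hd⟩ := dist_insertSquareGerm_lt h hε
  refine ⟨_, insertSquareGerm_mem_holderSet hα0 hα hh hδ.le hδ', hd, δ, hδ, by linarith,
    fun t h0 ht => ?_⟩
  rw [IccExtend_of_mem _ _ (⟨h0, by linarith⟩ : t ∈ Icc (0 : ℝ) 1)]
  exact insertSquareGerm_eq h hδ.le ht

lemma dense_convexGerm_holderSet {α : ℝ} (hα0 : 0 ≤ α) (hα : α ≤ 1) :
    Dense {f : HolderSet α | ConvexGerm (IccExtend zero_le_one f.1)} := by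
  refine Metric.dense_iff.2 fun f ε hε => ?_
  obtain ⟨k, hk, hd, δ, hδ, -, hsq⟩ := exists_mem_holderSet_sq_germ hα0 hα f.2 hε
  refine ⟨⟨k, hk⟩, hd, convexGerm_of_sq hδ fun t h0 ht => ?_⟩
  rw [hsq t h0 ht, hsq 0 le_rfl hδ.le]
  simp

/-- The antiderivative on `[0, 1]` of `h` with value `c` at the origin. -/
noncomputable def antiderivIcc (c : ℝ) (h : C(Icc (0 : ℝ) 1, ℝ)) : C(Icc (0 : ℝ) 1, ℝ) where
  toFun t := c + ∫ u in (0 : ℝ)..t, IccExtend zero_le_one h u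
  continuous_toFun := continuous_const.add <|
    (intervalIntegral.continuous_primitive
      (fun a b => h.continuous.Icc_extend'.intervalIntegrable a b) 0).comp continuous_subtype_val

lemma antiderivIcc_apply (c : ℝ) (h : C(Icc (0 : ℝ) 1, ℝ)) (t : Icc (0 : ℝ) 1) :
    antiderivIcc c h t = c + ∫ u in (0 : ℝ)..t, IccExtend zero_le_one h u := rfl

lemma hasDerivWithinAt_iff_eq_antiderivIcc (f h : C(Icc (0 : ℝ) 1, ℝ)) :
    (∀ x : Icc (0 : ℝ) 1,
      HasDerivWithinAt (IccExtend zero_le_one f) (h x) (Icc 0 1) (x : ℝ)) ↔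
      f = antiderivIcc (f 0) h := by
  have hcont : Continuous (IccExtend zero_le_one h) := h.continuous.Icc_extend'
  constructor
  · intro hd
    ext t
    have := intervalIntegral.integral_eq_sub_of_hasDerivAt_of_le (a := 0) (b := t) t.2.1
      (f := IccExtend zero_le_one f) (f' := IccExtend zero_le_one h)
      f.continuous.Icc_extend'.continuousOn (fun x hx => by
        have hx' : x ∈ Icc (0 : ℝ) 1 := ⟨hx.1.le, hx.2.le.trans t.2.2⟩
        rw [IccExtend_of_mem _ _ hx']
        exact (hd ⟨x, hx'⟩).hasDerivAt (Icc_mem_nhds hx.1 (hx.2.trans_le t.2.2)))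
      (hcont.intervalIntegrable _ _)
    rw [antiderivIcc_apply, this, IccExtend_val, IccExtend_left]
    exact (add_sub_cancel _ _).symm
  · intro hf x
    have hd : HasDerivAt (fun t => f 0 + ∫ u in (0 : ℝ)..t, IccExtend zero_le_one h u) (h x) x := by
      simpa using (hcont.integral_hasStrictDerivAt 0 (x : ℝ)).hasDerivAt.const_add (f 0)
    refine hd.hasDerivWithinAt.congr_of_mem (fun t ht => ?_) x.2
    rw [IccExtend_of_mem _ _ ht]
    exact DFunLike.congr_fun hf ⟨t, ht⟩

lemma mem_c1HolderSet_iff {β : ℝ} {p : C(Icc (0 : ℝ) 1, ℝ) × C(Icc (0 : ℝ) 1, ℝ)} :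
    p ∈ C1HolderSet β ↔ p.1 = antiderivIcc (p.1 0) p.2 ∧ p.2 ∈ HolderSet β :=
  and_congr (hasDerivWithinAt_iff_eq_antiderivIcc _ _) Iff.rfl

lemma isClosed_c1HolderSet (β : ℝ) : IsClosed (C1HolderSet β) := by
  have h : C1HolderSet β = {p | (∀ t : Icc (0 : ℝ) 1, p.1 t = antiderivIcc (p.1 0) p.2 t) ∧
      p.2 ∈ HolderSet β} := by
    ext p
    rw [mem_c1HolderSet_iff, ContinuousMap.ext_iff]
    rfl
  rw [h, ofPred_and, ofPred_forall]
  refine (isClosed_iInter fun t => isClosed_eq (by fun_prop) ?_).inter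
    ((isClosed_holderSet β).preimage continuous_snd)
  simp only [antiderivIcc_apply]
  refine (by fun_prop : Continuous fun p : C(Icc (0 : ℝ) 1, ℝ) × C(Icc (0 : ℝ) 1, ℝ) =>
    p.1 0).add ?_
  refine intervalIntegral.continuous_parametric_intervalIntegral_of_continuous' ?_ 0 (t : ℝ)
  have := continuous_projIcc (a := (0 : ℝ)) (h := zero_le_one)
  unfold Function.uncurry IccExtend
  simp only [Function.comp_def]
  fun_prop

lemma dist_antiderivIcc_le (c : ℝ) (h k : C(Icc (0 : ℝ) 1, ℝ)) :
    dist (antiderivIcc c h) (antiderivIcc c k) ≤ dist h k := by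
  refine (ContinuousMap.dist_le dist_nonneg).2 fun t => ?_
  rw [antiderivIcc_apply, antiderivIcc_apply, dist_add_left, Real.dist_eq,
    ← intervalIntegral.integral_sub (h.continuous.Icc_extend'.intervalIntegrable _ _)
      (k.continuous.Icc_extend'.intervalIntegrable _ _), ← Real.norm_eq_abs]
  refine (intervalIntegral.norm_integral_le_of_norm_le_const (C := dist h k) fun u _ => ?_).trans ?_
  · rw [← dist_eq_norm]
    exact ContinuousMap.dist_apply_le_dist _
  · rw [sub_zero, abs_of_nonneg t.2.1]
    exact mul_le_of_le_one_right dist_nonneg t.2.2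

lemma antiderivIcc_cube_germ {c δ : ℝ} {k : C(Icc (0 : ℝ) 1, ℝ)} (hδ : δ ≤ 1)
    (hk : ∀ t, 0 ≤ t → t ≤ δ → IccExtend zero_le_one k t = k 0 + t ^ 2) {t : ℝ} (h0 : 0 ≤ t)
    (ht : t ≤ δ) :
    IccExtend zero_le_one (antiderivIcc c k) t = c + k 0 * t + t ^ 3 / 3 := by
  rw [IccExtend_of_mem _ _ (⟨h0, ht.trans hδ⟩ : t ∈ Icc (0 : ℝ) 1), antiderivIcc_apply,
    intervalIntegral.integral_congr (g := fun u => k 0 + u ^ 2) fun u hu => ?_]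
  · rw [intervalIntegral.integral_add (by simp) (by simp)]
    simp
    ring
  · rw [uIcc_of_le h0] at hu
    exact hk u hu.1 (hu.2.trans ht)

lemma dense_convexGerm_c1HolderSet {β : ℝ} (hβ0 : 0 ≤ β) (hβ : β ≤ 1) :
    Dense {p : C1HolderSet β |
      ConvexGerm fun t => IccExtend zero_le_one p.1.1 t - p.1.2 0 * t} := by
  refine Metric.dense_iff.2 fun p ε hε => ?_
  obtain ⟨hp1, hp2⟩ := mem_c1HolderSet_iff.1 p.2
  obtain ⟨k, hk, hd, δ, hδ, hδ1, hsq⟩ := exists_mem_holderSet_sq_germ hβ0 hβ hp2 hε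
  have h0 : antiderivIcc (p.1.1 0) k 0 = p.1.1 0 := by simp [antiderivIcc_apply]
  refine ⟨⟨(antiderivIcc (p.1.1 0) k, k), mem_c1HolderSet_iff.2 ⟨by rw [h0], hk⟩⟩, ?_, ?_⟩
  · refine Metric.mem_ball.2 (max_lt ?_ hd)
    change dist (antiderivIcc (p.1.1 0) k) p.1.1 < ε
    calc dist (antiderivIcc (p.1.1 0) k) p.1.1
        = dist (antiderivIcc (p.1.1 0) k) (antiderivIcc (p.1.1 0) p.1.2) := by rw [← hp1]
      _ ≤ dist k p.1.2 := dist_antiderivIcc_le _ _ _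
      _ < ε := hd
  · change ConvexGerm fun t => IccExtend zero_le_one (antiderivIcc (p.1.1 0) k) t - k 0 * t
    refine convexGerm_of_cube hδ fun t ht htδ => ?_
    rw [antiderivIcc_cube_germ hδ1 hsq ht htδ, antiderivIcc_cube_germ hδ1 hsq le_rfl hδ.le]
    ring

theorem generic_convex_restriction_large_box_dim (α : ℝ) (hα0 : 0 ≤ α) (hα2 : α < 2) :
    (α < 1 → ∃ G : Set (HolderSet α), Dense G ∧ IsGδ G ∧
      ∀ f ∈ G, ∃ A ⊆ Icc (0:ℝ) 1, IsClosed A ∧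
        ConvexOnSet (Set.IccExtend zero_le_one ⇑f.1) A ∧
        upperMinkowskiDim A = 1) ∧
    (1 ≤ α → ∃ G : Set (C1HolderSet (α - 1)), Dense G ∧ IsGδ G ∧
      ∀ f ∈ G, ∃ A ⊆ Icc (0:ℝ) 1, IsClosed A ∧
        ConvexOnSet (Set.IccExtend zero_le_one ⇑f.1.1) A ∧
        upperMinkowskiDim A = 1) := by
  have hproj := continuous_projIcc (a := (0 : ℝ)) (h := zero_le_one)
  refine ⟨fun hα1 => ?_, fun hα1 => ?_⟩
  · have : CompleteSpace (HolderSet α) := (isClosed_holderSet α).completeSpace_coe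
    exact exists_dense_Gδ_convexOnSet (F := fun f : HolderSet α => IccExtend zero_le_one f.1)
      (fun f => f.1.continuous.Icc_extend')
      (fun t => by fun_prop)
      (dense_convexGerm_holderSet hα0 hα1.le)
  · have : CompleteSpace (C1HolderSet (α - 1)) := (isClosed_c1HolderSet _).completeSpace_coe
    obtain ⟨G, hG, hGδ, h⟩ := exists_dense_Gδ_convexOnSet
      (F := fun (p : C1HolderSet (α - 1)) t => IccExtend zero_le_one p.1.1 t - p.1.2 0 * t)
      (fun p => p.1.1.continuous.Icc_extend'.sub (by fun_prop))
      (fun t => by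
        simp only [IccExtend, Function.comp_def]
        fun_prop)
      (dense_convexGerm_c1HolderSet (by linarith) (by linarith))
    refine ⟨G, hG, hGδ, fun p hp => ?_⟩
    obtain ⟨A, hA, hcl, hconv, hdim⟩ := h p hp
    exact ⟨A, hA, hcl, hconv.of_sub_linear _, hdim⟩
end
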